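/- Let D_A, D_B, D_X, D_Y, D_C be sets and let Q be a nonempty finite subset of D_A × D_B × D_X × D_Y × D_C. Suppose Q satisfies the following six functional dependencies: any two tuples of Q that agree on the coordinates {A,B} are equal; likewise for the coordinate sets {A,X,Y}, {B,X,Y}, {A,C}, {X,C}, and {Y,C}. Then |Q|¹¹ ≤ |Π_{X,Y}(Q)|³ · |Π_{A,X}(Q)|³ · |Π_{A,Y}(Q)|³ · |Π_{B,X}(Q)| · |Π_{B,Y}(Q)| · |Π_{C}(Q)|⁵, where Π_S(Q) denotes the image of Q under projection onto the coordinates in S. -/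

import Mathlib

open scoped Classical

section Entropy

variable {ι α β γ δ : Type*} [Fintype ι]

/-- The mass, under the weights `w`, of the fiber of `f` through `i`. -/
noncomputable def fiberMass (w : ι → ℝ) (f : ι → α) (i : ι) : ℝ :=
  ∑ j with f j = f i, w j

/-- The Shannon entropy of `f` under the weights `w`. -/
noncomputable def shannonEntropy (w : ι → ℝ) (f : ι → α) : ℝ :=
  -∑ i, w i * Real.log (fiberMass w f i)

lemma fiberMass_pos {w : ι → ℝ} (hw : ∀ i, 0 ≤ w i) (f : ι → α) {i : ι} (hi : 0 < w i) :
    0 < fiberMass w f i :=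
  hi.trans_le <| Finset.single_le_sum (f := w) (fun j _ => hw j) (by simp)

lemma fiberMass_nonneg {w : ι → ℝ} (hw : ∀ i, 0 ≤ w i) (f : ι → α) (i : ι) :
    0 ≤ fiberMass w f i :=
  Finset.sum_nonneg fun j _ => hw j

lemma fiberMass_eq_of_eq (w : ι → ℝ) {f : ι → α} {i j : ι} (h : f i = f j) :
    fiberMass w f i = fiberMass w f j := by
  simp only [fiberMass, h]

lemma shannonEntropy_congr (w : ι → ℝ) {f : ι → α} {g : ι → β}
    (h : ∀ i j, w i ≠ 0 → w j ≠ 0 → (f i = f j ↔ g i = g j)) :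
    shannonEntropy w f = shannonEntropy w g := by
  unfold shannonEntropy
  congr 1
  refine Finset.sum_congr rfl fun i _ => ?_
  by_cases hi : w i = 0
  · simp [hi]
  congr 2
  simp only [fiberMass, Finset.sum_filter]
  refine Finset.sum_congr rfl fun j _ => ?_
  by_cases hj : w j = 0
  · simp [hj]
  · simp only [h j i hj hi]

lemma shannonEntropy_comp_equiv {w : ι → ℝ} (e : ι ≃ ι) (he : ∀ i, w (e i) = w i) (f : ι → α) :
    shannonEntropy w (f ∘ e) = shannonEntropy w f := by
  have hm (i : ι) : fiberMass w (f ∘ e) i = fiberMass w f (e i) := by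
    simp only [fiberMass, Finset.sum_filter]
    rw [← Equiv.sum_comp e (fun j => if f j = f (e i) then w j else 0)]
    simp [he]
  unfold shannonEntropy
  rw [← Equiv.sum_comp e (fun i => w i * Real.log (fiberMass w f i))]
  simp [he, hm]

/-- An entropy-type sum is nonpositive as soon as the averaged ratio is at most one. -/
lemma sum_mul_log_nonpos {w r : ι → ℝ} (hw : ∀ i, 0 ≤ w i) (hw1 : ∑ i, w i = 1)
    (hr : ∀ i, 0 < w i → 0 < r i) (h : ∑ i, w i * r i ≤ 1) :
    ∑ i, w i * Real.log (r i) ≤ 0 := by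
  have : ∑ i, w i * Real.log (r i) ≤ ∑ i, (w i * r i - w i) := by
    refine Finset.sum_le_sum fun i _ => ?_
    rcases (hw i).eq_or_lt with h0 | h0
    · simp [← h0]
    · nlinarith [Real.log_le_sub_one_of_pos (hr i h0)]
  rw [Finset.sum_sub_distrib, hw1] at this
  linarith

lemma sum_fiber_div_fiberMass_le_one {w : ι → ℝ} (f : ι → α) (v : α) :
    ∑ i with f i = v, w i / fiberMass w f i ≤ 1 := by
  have : ∑ i with f i = v, w i / fiberMass w f i
      = (∑ i with f i = v, w i) / ∑ i with f i = v, w i := by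
    rw [Finset.sum_div]
    refine Finset.sum_congr rfl fun i hi => ?_
    rw [fiberMass, (Finset.mem_filter.mp hi).2]
  rw [this]
  exact div_self_le_one _

lemma shannonEntropy_le_log_card {w : ι → ℝ} (hw : ∀ i, 0 ≤ w i) (hw1 : ∑ i, w i = 1)
    (f : ι → α) (s : Finset α) (hs : ∀ i, f i ∈ s) :
    shannonEntropy w f ≤ Real.log s.card := by
  have : Nonempty ι := by
    by_contra h
    rw [not_nonempty_iff] at h
    simp at hw1
  obtain ⟨i₀⟩ := this
  have hc : (0 : ℝ) < s.card := by exact_mod_cast Finset.card_pos.mpr ⟨_, hs i₀⟩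
  have key := sum_mul_log_nonpos (r := fun i => (s.card * fiberMass w f i)⁻¹) hw hw1
    (fun i hi => inv_pos.mpr (mul_pos hc (fiberMass_pos hw f hi))) (by
      have h1 : ∑ i, w i / fiberMass w f i ≤ s.card := by
        rw [← Finset.sum_fiberwise_of_maps_to (s := Finset.univ) (t := s) (g := f)
          (fun i _ => hs i)]
        calc _ ≤ ∑ _v ∈ s, (1 : ℝ) :=
              Finset.sum_le_sum fun v _ => sum_fiber_div_fiberMass_le_one f v
          _ = s.card := by simp
      calc ∑ i, w i * (s.card * fiberMass w f i)⁻¹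
          = (∑ i, w i / fiberMass w f i) / s.card := by
            rw [Finset.sum_div]
            refine Finset.sum_congr rfl fun i _ => ?_
            rw [mul_inv]; ring
        _ ≤ 1 := (div_le_one hc).mpr h1)
  have hsum : ∑ i, w i * Real.log ((s.card * fiberMass w f i)⁻¹)
      = shannonEntropy w f - Real.log s.card := by
    have : Real.log s.card = ∑ i, w i * Real.log s.card := by
      rw [← Finset.sum_mul, hw1, one_mul]
    rw [this, shannonEntropy, ← Finset.sum_neg_distrib, ← Finset.sum_sub_distrib]
    refine Finset.sum_congr rfl fun i _ => ?_
    rcases (hw i).eq_or_lt with h0 | h0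
    · simp [← h0]
    · rw [Real.log_inv, Real.log_mul hc.ne' (fiberMass_pos hw f h0).ne']
      ring
  linarith

lemma shannonEntropy_const {w : ι → ℝ} (hw1 : ∑ i, w i = 1) (c : α) :
    shannonEntropy w (fun _ => c) = 0 := by
  simp [shannonEntropy, fiberMass, hw1]

/-- Submodularity of Shannon entropy: `t` is the join of `u` and `v`, and `m` is a function of
each of `u` and `v`. -/
lemma shannonEntropy_submodular {w : ι → ℝ} (hw : ∀ i, 0 ≤ w i) (hw1 : ∑ i, w i = 1)
    {u : ι → α} {v : ι → β} {t : ι → γ} {m : ι → δ}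
    (ht : ∀ i j, t i = t j ↔ u i = u j ∧ v i = v j)
    (hum : ∀ i j, u i = u j → m i = m j) (hvm : ∀ i j, v i = v j → m i = m j) :
    shannonEntropy w t + shannonEntropy w m ≤ shannonEntropy w u + shannonEntropy w v := by
  have inner (j l : ι) : ∑ i, (if u j = u i ∧ v l = v i then
        w i / (fiberMass w t i * fiberMass w m i) else 0)
      ≤ if m l = m j then (fiberMass w m j)⁻¹ else 0 := by
    by_cases hex : ∃ i, u j = u i ∧ v l = v i
    · obtain ⟨i₀, hu, hv⟩ := hex
      have hm : m l = m j := (hvm _ _ hv).trans (hum _ _ hu).symm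
      rw [if_pos hm, ← Finset.sum_filter]
      have hfilter : (Finset.univ.filter fun i => u j = u i ∧ v l = v i)
          = Finset.univ.filter fun i => t i = t i₀ := by
        ext i
        simp only [Finset.mem_filter, Finset.mem_univ, true_and, ht, hu, hv]
        exact ⟨fun h => ⟨h.1.symm, h.2.symm⟩, fun h => ⟨h.1.symm, h.2.symm⟩⟩
      rw [hfilter]
      calc ∑ i with t i = t i₀, w i / (fiberMass w t i * fiberMass w m i)
          = (∑ i with t i = t i₀, w i / fiberMass w t i) * (fiberMass w m j)⁻¹ := by
            rw [Finset.sum_mul]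
            refine Finset.sum_congr rfl fun i hi => ?_
            have hi := ((ht _ _).mp (Finset.mem_filter.mp hi).2).1
            rw [fiberMass_eq_of_eq w (hum _ _ (hi.trans hu.symm)), ← div_div]
            rfl
        _ ≤ 1 * (fiberMass w m j)⁻¹ :=
            mul_le_mul_of_nonneg_right (sum_fiber_div_fiberMass_le_one t _)
              (inv_nonneg.mpr (fiberMass_nonneg hw m j))
        _ = _ := one_mul _
    · have h0 : ∀ i, ¬(u j = u i ∧ v l = v i) := fun i hi => hex ⟨i, hi⟩
      simp only [h0, if_false, Finset.sum_const_zero]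
      split_ifs
      · exact inv_nonneg.mpr (fiberMass_nonneg hw m j)
      · rfl
  have hratio : ∑ i, w i * (fiberMass w u i * fiberMass w v i /
      (fiberMass w t i * fiberMass w m i)) ≤ 1 := by
    calc ∑ i, w i * (fiberMass w u i * fiberMass w v i / (fiberMass w t i * fiberMass w m i))
        = ∑ i, ∑ j, ∑ l, w j * w l * (if u j = u i ∧ v l = v i then
            w i / (fiberMass w t i * fiberMass w m i) else 0) := by
          refine Finset.sum_congr rfl fun i _ => ?_
          have hprod : fiberMass w u i * fiberMass w v i
              = ∑ j, ∑ l, w j * w l * (if u j = u i ∧ v l = v i then 1 else 0) := by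
            rw [fiberMass, fiberMass, Finset.sum_filter, Finset.sum_filter,
              Finset.sum_mul_sum]
            refine Finset.sum_congr rfl fun j _ => Finset.sum_congr rfl fun l _ => ?_
            by_cases h1 : u j = u i <;> by_cases h2 : v l = v i <;> simp [h1, h2]
          rw [hprod, mul_div_assoc', mul_comm, mul_div_assoc, Finset.sum_mul]
          refine Finset.sum_congr rfl fun j _ => ?_
          rw [Finset.sum_mul]
          refine Finset.sum_congr rfl fun l _ => ?_
          split_ifs <;> ring
      _ = ∑ j, ∑ l, w j * w l * ∑ i, (if u j = u i ∧ v l = v i then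
            w i / (fiberMass w t i * fiberMass w m i) else 0) := by
          rw [Finset.sum_comm]
          refine Finset.sum_congr rfl fun j _ => ?_
          rw [Finset.sum_comm]
          simp only [Finset.mul_sum]
      _ ≤ ∑ j, ∑ l, w j * w l * (if m l = m j then (fiberMass w m j)⁻¹ else 0) :=
          Finset.sum_le_sum fun j _ => Finset.sum_le_sum fun l _ =>
            mul_le_mul_of_nonneg_left (inner j l) (mul_nonneg (hw j) (hw l))
      _ = ∑ j, w j * (fiberMass w m j / fiberMass w m j) := by
          refine Finset.sum_congr rfl fun j _ => ?_
          rw [div_eq_mul_inv]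
          conv_rhs => rw [fiberMass, Finset.sum_filter, Finset.sum_mul, Finset.mul_sum]
          refine Finset.sum_congr rfl fun l _ => ?_
          split_ifs
          · rw [← Finset.sum_filter, ← fiberMass]; ring
          · ring
      _ ≤ ∑ j, w j * 1 :=
          Finset.sum_le_sum fun j _ => mul_le_mul_of_nonneg_left (div_self_le_one _) (hw j)
      _ = 1 := by simpa using hw1
  have key := sum_mul_log_nonpos hw hw1 (fun i hi => div_pos
    (mul_pos (fiberMass_pos hw u hi) (fiberMass_pos hw v hi))
    (mul_pos (fiberMass_pos hw t hi) (fiberMass_pos hw m hi))) hratio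
  have hsum : ∑ i, w i * Real.log (fiberMass w u i * fiberMass w v i /
      (fiberMass w t i * fiberMass w m i)) = shannonEntropy w t + shannonEntropy w m
        - shannonEntropy w u - shannonEntropy w v := by
    simp only [shannonEntropy, ← Finset.sum_neg_distrib, ← Finset.sum_sub_distrib,
      ← Finset.sum_add_distrib]
    refine Finset.sum_congr rfl fun i _ => ?_
    rcases (hw i).eq_or_lt with h0 | h0
    · simp [← h0]
    · have hu := fiberMass_pos hw u h0
      have hv := fiberMass_pos hw v h0
      have ht := fiberMass_pos hw t h0
      have hm := fiberMass_pos hw m h0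
      rw [Real.log_div (mul_pos hu hv).ne' (mul_pos ht hm).ne', Real.log_mul hu.ne' hv.ne',
        Real.log_mul ht.ne' hm.ne']
      ring
  linarith

lemma shannonEntropy_prod_le {w : ι → ℝ} (hw : ∀ i, 0 ≤ w i) (hw1 : ∑ i, w i = 1)
    {u : ι → α} {v : ι → β} {t : ι → γ} (ht : ∀ i j, t i = t j ↔ u i = u j ∧ v i = v j) :
    shannonEntropy w t ≤ shannonEntropy w u + shannonEntropy w v := by
  have := shannonEntropy_submodular hw hw1 (m := fun _ => ()) ht (by simp) (by simp)
  rwa [shannonEntropy_const hw1, add_zero] at this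

end Entropy

section Copy

variable {σ κ : Type*} [Fintype σ]

/-- The weights of two copies of a uniform element of `σ`, conditionally independent given the
value of `f`. -/
noncomputable def copyWeight (f : σ → κ) (p : σ × σ) : ℝ :=
  if f p.2 = f p.1 then ((Fintype.card σ : ℝ) * (Finset.univ.filter fun s => f s = f p.1).card)⁻¹
  else 0

lemma card_fiber_pos (f : σ → κ) (s : σ) :
    (0 : ℝ) < (Finset.univ.filter fun s' => f s' = f s).card := by
  exact_mod_cast Finset.card_pos.mpr ⟨s, by simp⟩

lemma copyWeight_nonneg (f : σ → κ) (p : σ × σ) : 0 ≤ copyWeight f p := by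
  unfold copyWeight
  split_ifs <;> positivity

lemma copyWeight_swap (f : σ → κ) (p : σ × σ) :
    copyWeight f (Equiv.prodComm σ σ p) = copyWeight f p := by
  unfold copyWeight
  by_cases h : f p.2 = f p.1
  · simp [h]
  · simp [h, Ne.symm h]

lemma sum_copyWeight_right (f : σ → κ) (s : σ) :
    ∑ s', copyWeight f (s, s') = (Fintype.card σ : ℝ)⁻¹ := by
  have := (card_fiber_pos f s).ne'
  simp only [copyWeight, ← Finset.sum_filter, Finset.sum_const, nsmul_eq_mul, mul_inv]
  field_simp

lemma fiberMass_copyWeight_comp_fst {α : Type*} (f : σ → κ) (g : σ → α) (p : σ × σ) :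
    fiberMass (copyWeight f) (fun p => g p.1) p
      = (Finset.univ.filter fun s => g s = g p.1).card * (Fintype.card σ : ℝ)⁻¹ := by
  rw [fiberMass, Finset.sum_filter, Fintype.sum_prod_type]
  rw [← nsmul_eq_mul, ← Finset.sum_const, Finset.sum_filter]
  refine Finset.sum_congr rfl fun s _ => ?_
  split_ifs
  · exact sum_copyWeight_right f s
  · exact Finset.sum_const_zero

lemma shannonEntropy_copyWeight_comp_snd {α : Type*} (f : σ → κ) (g : σ → α) :
    shannonEntropy (copyWeight f) (fun p => g p.2)
      = shannonEntropy (copyWeight f) (fun p => g p.1) :=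
  shannonEntropy_comp_equiv (Equiv.prodComm σ σ) (copyWeight_swap f) (fun p => g p.1)

/-- A statistic of both copies which only reads, from the first copy, a function of the shared
value has the same entropy as the corresponding statistic of a single copy. -/
lemma shannonEntropy_copyWeight_snd_fst {α β : Type*} (f : σ → κ) (g : σ → α) (h : σ → β)
    (hfh : ∀ s s', f s = f s' → h s = h s') :
    shannonEntropy (copyWeight f) (fun p => (g p.2, h p.1))
      = shannonEntropy (copyWeight f) (fun p => (g p.1, h p.1)) := by
  rw [← shannonEntropy_copyWeight_comp_snd f (fun s => (g s, h s))]
  have hsupp (p : σ × σ) (hp : copyWeight f p ≠ 0) : h p.1 = h p.2 := by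
    by_contra hne
    exact hp (if_neg fun h' => hne (hfh _ _ h'.symm))
  refine shannonEntropy_congr _ fun p p' hp hp' => ?_
  simp only [hsupp p hp, hsupp p' hp']

variable [Nonempty σ]

lemma sum_copyWeight (f : σ → κ) : ∑ p, copyWeight f p = 1 := by
  rw [Fintype.sum_prod_type]
  simp [sum_copyWeight_right]

lemma shannonEntropy_copyWeight_of_injective {α : Type*} (f : σ → κ) {g : σ → α}
    (hg : ∀ s s', g s = g s' → s = s') :
    shannonEntropy (copyWeight f) (fun p => g p.1) = Real.log (Fintype.card σ) := by
  have h1 (s : σ) : (Finset.univ.filter fun s' => g s' = g s) = {s} := by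
    ext s'
    simpa using ⟨hg s' s, fun h => h ▸ rfl⟩
  simp only [shannonEntropy, fiberMass_copyWeight_comp_fst, h1, Finset.card_singleton,
    Nat.cast_one, one_mul]
  rw [← Finset.sum_mul, sum_copyWeight]
  simp

/-- Conditional independence of the two copies. -/
lemma shannonEntropy_copyWeight_of_injective_pair {α : Type*} (f : σ → κ) {g : σ × σ → α}
    (hg : ∀ p p', f p.2 = f p.1 → f p'.2 = f p'.1 → g p = g p' → p = p') :
    shannonEntropy (copyWeight f) g + shannonEntropy (copyWeight f) (fun p => f p.1)
      = 2 * Real.log (Fintype.card σ) := by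
  have hmass (p : σ × σ) (hp : f p.2 = f p.1) : fiberMass (copyWeight f) g p
      = ((Fintype.card σ : ℝ) * (Finset.univ.filter fun s => f s = f p.1).card)⁻¹ := by
    rw [fiberMass, Finset.sum_eq_single p, copyWeight, if_pos hp]
    · intro p' hp' hne
      exact if_neg fun h => hne (hg p' p h hp (Finset.mem_filter.mp hp').2)
    · simp
  have hterm (p : σ × σ) : -(copyWeight f p * Real.log (fiberMass (copyWeight f) g p))
      + -(copyWeight f p * Real.log (fiberMass (copyWeight f) (fun p => f p.1) p))
      = copyWeight f p * (2 * Real.log (Fintype.card σ)) := by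
    by_cases hp : f p.2 = f p.1
    · have hc : (Fintype.card σ : ℝ) ≠ 0 := by exact_mod_cast Fintype.card_ne_zero
      have hn := (card_fiber_pos f p.1).ne'
      rw [hmass p hp, fiberMass_copyWeight_comp_fst, Real.log_inv, Real.log_mul hc hn,
        Real.log_mul hn (inv_ne_zero hc), Real.log_inv]
      ring
    · simp [copyWeight, hp]
  simp only [shannonEntropy]
  rw [← Finset.sum_neg_distrib, ← Finset.sum_neg_distrib, ← Finset.sum_add_distrib,
    Finset.sum_congr rfl fun p _ => hterm p, ← Finset.sum_mul, sum_copyWeight, one_mul]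

end Copy

/-- Logarithmic form of the output bound, for functions on a finite type. -/
lemma zhang_yeung_log_bound {σ α β ξ υ γ : Type*} [Fintype σ] [Nonempty σ]
    (a : σ → α) (b : σ → β) (x : σ → ξ) (y : σ → υ) (c : σ → γ)
    (hab : ∀ s s', a s = a s' → b s = b s' → s = s')
    (haxy : ∀ s s', a s = a s' → x s = x s' → y s = y s' → s = s')
    (hbxy : ∀ s s', b s = b s' → x s = x s' → y s = y s' → s = s')
    (hac : ∀ s s', a s = a s' → c s = c s' → s = s')
    (hxc : ∀ s s', x s = x s' → c s = c s' → s = s')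
    (hyc : ∀ s s', y s = y s' → c s = c s' → s = s')
    (sxy : Finset (ξ × υ)) (sax : Finset (α × ξ)) (say : Finset (α × υ))
    (sbx : Finset (β × ξ)) (sby : Finset (β × υ)) (sc : Finset γ)
    (hsxy : ∀ s, (x s, y s) ∈ sxy) (hsax : ∀ s, (a s, x s) ∈ sax) (hsay : ∀ s, (a s, y s) ∈ say)
    (hsbx : ∀ s, (b s, x s) ∈ sbx) (hsby : ∀ s, (b s, y s) ∈ sby) (hsc : ∀ s, c s ∈ sc) :
    11 * Real.log (Fintype.card σ) ≤ 3 * Real.log sxy.card + 3 * Real.log sax.card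
      + 3 * Real.log say.card + Real.log sbx.card + Real.log sby.card + 5 * Real.log sc.card := by
  set f : σ → ξ × υ := fun s => (x s, y s) with hf
  have hw := copyWeight_nonneg f
  have hw1 := sum_copyWeight f
  have hfx : ∀ s s', f s = f s' → x s = x s' := fun s s' h => congrArg Prod.fst h
  have hfy : ∀ s s', f s = f s' → y s = y s' := fun s s' h => congrArg Prod.snd h
  have bxy := shannonEntropy_le_log_card hw hw1 (fun p => f p.1) sxy fun p => hsxy p.1
  have bax := shannonEntropy_le_log_card hw hw1 (fun p => (a p.1, x p.1)) sax fun p => hsax p.1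
  have bay := shannonEntropy_le_log_card hw hw1 (fun p => (a p.1, y p.1)) say fun p => hsay p.1
  have bbx := shannonEntropy_le_log_card hw hw1 (fun p => (b p.1, x p.1)) sbx fun p => hsbx p.1
  have bby := shannonEntropy_le_log_card hw hw1 (fun p => (b p.1, y p.1)) sby fun p => hsby p.1
  have bc := shannonEntropy_le_log_card hw hw1 (fun p => c p.1) sc fun p => hsc p.1
  have eac := shannonEntropy_copyWeight_of_injective f (g := fun s => (a s, c s))
    fun s s' h => hac s s' (congrArg Prod.fst h) (congrArg Prod.snd h)
  have exc := shannonEntropy_copyWeight_of_injective f (g := fun s => (x s, c s))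
    fun s s' h => hxc s s' (congrArg Prod.fst h) (congrArg Prod.snd h)
  have eyc := shannonEntropy_copyWeight_of_injective f (g := fun s => (y s, c s))
    fun s s' h => hyc s s' (congrArg Prod.fst h) (congrArg Prod.snd h)
  have lac := shannonEntropy_prod_le hw hw1 (t := fun p => (a p.1, c p.1))
    (u := fun p => a p.1) (v := fun p => c p.1) (by simp)
  have lxc := shannonEntropy_prod_le hw hw1 (t := fun p => (x p.1, c p.1))
    (u := fun p => x p.1) (v := fun p => c p.1) (by simp)
  have lyc := shannonEntropy_prod_le hw hw1 (t := fun p => (y p.1, c p.1))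
    (u := fun p => y p.1) (v := fun p => c p.1) (by simp)
  -- The copy of `a` is jointly distributed with `x` and with `y` as `a` is.
  have ea := shannonEntropy_copyWeight_comp_snd f a
  have eax := shannonEntropy_copyWeight_snd_fst f a x hfx
  have eay := shannonEntropy_copyWeight_snd_fst f a y hfy
  have tab := shannonEntropy_copyWeight_of_injective_pair f
    (g := fun p => (a p.2, a p.1, b p.1)) (by
      rintro ⟨p, q⟩ ⟨p', q'⟩ h h' hg
      simp only [hf, Prod.mk.injEq] at h h' hg ⊢
      obtain rfl := hab p p' hg.2.1 hg.2.2
      exact ⟨rfl, haxy q q' hg.1 (h.1.trans h'.1.symm) (h.2.trans h'.2.symm)⟩)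
  have taxy := shannonEntropy_copyWeight_of_injective_pair f
    (g := fun p => (a p.2, a p.1, x p.1, y p.1)) (by
      rintro ⟨p, q⟩ ⟨p', q'⟩ h h' hg
      simp only [hf, Prod.mk.injEq] at h h' hg ⊢
      obtain rfl := haxy p p' hg.2.1 hg.2.2.1 hg.2.2.2
      exact ⟨rfl, haxy q q' hg.1 (h.1.trans h'.1.symm) (h.2.trans h'.2.symm)⟩)
  have tbxy := shannonEntropy_copyWeight_of_injective_pair f
    (g := fun p => (a p.2, b p.1, x p.1, y p.1)) (by
      rintro ⟨p, q⟩ ⟨p', q'⟩ h h' hg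
      simp only [hf, Prod.mk.injEq] at h h' hg ⊢
      obtain rfl := hbxy p p' hg.2.1 hg.2.2.1 hg.2.2.2
      exact ⟨rfl, haxy q q' hg.1 (h.1.trans h'.1.symm) (h.2.trans h'.2.symm)⟩)
  have iab := shannonEntropy_submodular hw hw1 (t := fun p => (a p.2, a p.1, b p.1))
    (u := fun p => (a p.2, a p.1)) (v := fun p => (a p.2, b p.1)) (m := fun p => a p.2)
    (by grind) (by grind) (by grind)
  have iaxy := shannonEntropy_submodular hw hw1 (t := fun p => (a p.2, a p.1, x p.1, y p.1))
    (u := fun p => (a p.2, a p.1, x p.1)) (v := fun p => (a p.2, a p.1, y p.1)) (m := fun p => (a p.2, a p.1))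
    (by grind) (by grind) (by grind)
  have ibxy := shannonEntropy_submodular hw hw1 (t := fun p => (a p.2, b p.1, x p.1, y p.1))
    (u := fun p => (a p.2, b p.1, x p.1)) (v := fun p => (a p.2, b p.1, y p.1)) (m := fun p => (a p.2, b p.1))
    (by grind) (by grind) (by grind)
  have iax := shannonEntropy_submodular hw hw1 (t := fun p => (a p.2, a p.1, x p.1))
    (u := fun p => (a p.2, x p.1)) (v := fun p => (a p.1, x p.1)) (m := fun p => x p.1)
    (by grind) (by grind) (by grind)
  have iay := shannonEntropy_submodular hw hw1 (t := fun p => (a p.2, a p.1, y p.1))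
    (u := fun p => (a p.2, y p.1)) (v := fun p => (a p.1, y p.1)) (m := fun p => y p.1)
    (by grind) (by grind) (by grind)
  have ibx := shannonEntropy_submodular hw hw1 (t := fun p => (a p.2, b p.1, x p.1))
    (u := fun p => (a p.2, x p.1)) (v := fun p => (b p.1, x p.1)) (m := fun p => x p.1)
    (by grind) (by grind) (by grind)
  have iby := shannonEntropy_submodular hw hw1 (t := fun p => (a p.2, b p.1, y p.1))
    (u := fun p => (a p.2, y p.1)) (v := fun p => (b p.1, y p.1)) (m := fun p => y p.1)
    (by grind) (by grind) (by grind)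
  linarith

lemma pow_le_of_log_le {n k₁ k₂ k₃ k₄ k₅ k₆ : ℕ} (hn : 0 < n) (h₁ : 0 < k₁) (h₂ : 0 < k₂)
    (h₃ : 0 < k₃) (h₄ : 0 < k₄) (h₅ : 0 < k₅) (h₆ : 0 < k₆)
    (h : 11 * Real.log n ≤ 3 * Real.log k₁ + 3 * Real.log k₂ + 3 * Real.log k₃ + Real.log k₄
      + Real.log k₅ + 5 * Real.log k₆) :
    n ^ 11 ≤ k₁ ^ 3 * k₂ ^ 3 * k₃ ^ 3 * k₄ * k₅ * k₆ ^ 5 := by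
  rw [← Nat.cast_le (α := ℝ)]
  push_cast
  rw [← Real.log_le_log_iff (by positivity) (by positivity),
    Real.log_mul (by positivity) (by positivity), Real.log_mul (by positivity) (by positivity),
    Real.log_mul (by positivity) (by positivity), Real.log_mul (by positivity) (by positivity),
    Real.log_mul (by positivity) (by positivity)]
  simp only [Real.log_pow]
  push_cast
  exact h

/-- **Output size bound for the Zhang–Yeung query.**
Let `Q` be a nonempty finite set of tuples in `D_A × D_B × D_X × D_Y × D_C`
satisfying the functional dependencies `{A,B} → all`, `{A,X,Y} → all`,
`{B,X,Y} → all`, `{A,C} → all`, `{X,C} → all`, `{Y,C} → all`. Then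
`|Q|¹¹ ≤ |Π_{XY}(Q)|³ · |Π_{AX}(Q)|³ · |Π_{AY}(Q)|³ · |Π_{BX}(Q)| ·
|Π_{BY}(Q)| · |Π_C(Q)|⁵`. -/
theorem zhang_yeung_output_bound {Da Db Dx Dy Dc : Type*}
    (Q : Finset (Da × Db × Dx × Dy × Dc)) (hQ : Q.Nonempty)
    (fdAB : ∀ q ∈ Q, ∀ q' ∈ Q,
      q.1 = q'.1 → q.2.1 = q'.2.1 → q = q')
    (fdAXY : ∀ q ∈ Q, ∀ q' ∈ Q,
      q.1 = q'.1 → q.2.2.1 = q'.2.2.1 → q.2.2.2.1 = q'.2.2.2.1 → q = q')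
    (fdBXY : ∀ q ∈ Q, ∀ q' ∈ Q,
      q.2.1 = q'.2.1 → q.2.2.1 = q'.2.2.1 → q.2.2.2.1 = q'.2.2.2.1 → q = q')
    (fdAC : ∀ q ∈ Q, ∀ q' ∈ Q,
      q.1 = q'.1 → q.2.2.2.2 = q'.2.2.2.2 → q = q')
    (fdXC : ∀ q ∈ Q, ∀ q' ∈ Q,
      q.2.2.1 = q'.2.2.1 → q.2.2.2.2 = q'.2.2.2.2 → q = q')
    (fdYC : ∀ q ∈ Q, ∀ q' ∈ Q,
      q.2.2.2.1 = q'.2.2.2.1 → q.2.2.2.2 = q'.2.2.2.2 → q = q') :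
    Q.card ^ 11 ≤
      (Q.image (fun q => (q.2.2.1, q.2.2.2.1))).card ^ 3 *
      (Q.image (fun q => (q.1, q.2.2.1))).card ^ 3 *
      (Q.image (fun q => (q.1, q.2.2.2.1))).card ^ 3 *
      (Q.image (fun q => (q.2.1, q.2.2.1))).card *
      (Q.image (fun q => (q.2.1, q.2.2.2.1))).card *
      (Q.image (fun q => q.2.2.2.2)).card ^ 5 := by
  have : Nonempty Q := hQ.to_subtype
  have key := zhang_yeung_log_bound (σ := Q) (fun q => q.1.1) (fun q => q.1.2.1)
    (fun q => q.1.2.2.1) (fun q => q.1.2.2.2.1) (fun q => q.1.2.2.2.2)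
    (fun q q' h₁ h₂ => Subtype.ext (fdAB q q.2 q' q'.2 h₁ h₂))
    (fun q q' h₁ h₂ h₃ => Subtype.ext (fdAXY q q.2 q' q'.2 h₁ h₂ h₃))
    (fun q q' h₁ h₂ h₃ => Subtype.ext (fdBXY q q.2 q' q'.2 h₁ h₂ h₃))
    (fun q q' h₁ h₂ => Subtype.ext (fdAC q q.2 q' q'.2 h₁ h₂))
    (fun q q' h₁ h₂ => Subtype.ext (fdXC q q.2 q' q'.2 h₁ h₂))
    (fun q q' h₁ h₂ => Subtype.ext (fdYC q q.2 q' q'.2 h₁ h₂))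
    (Q.image fun q => (q.2.2.1, q.2.2.2.1)) (Q.image fun q => (q.1, q.2.2.1))
    (Q.image fun q => (q.1, q.2.2.2.1)) (Q.image fun q => (q.2.1, q.2.2.1))
    (Q.image fun q => (q.2.1, q.2.2.2.1)) (Q.image fun q => q.2.2.2.2)
    (fun q => Finset.mem_image_of_mem (fun q => (q.2.2.1, q.2.2.2.1)) q.2)
    (fun q => Finset.mem_image_of_mem (fun q => (q.1, q.2.2.1)) q.2)
    (fun q => Finset.mem_image_of_mem (fun q => (q.1, q.2.2.2.1)) q.2)
    (fun q => Finset.mem_image_of_mem (fun q => (q.2.1, q.2.2.1)) q.2)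
    (fun q => Finset.mem_image_of_mem (fun q => (q.2.1, q.2.2.2.1)) q.2)
    (fun q => Finset.mem_image_of_mem (fun q => q.2.2.2.2) q.2)
  rw [Fintype.card_coe] at key
  exact pow_le_of_log_le hQ.card_pos (hQ.image _).card_pos (hQ.image _).card_pos
    (hQ.image _).card_pos (hQ.image _).card_pos (hQ.image _).card_pos (hQ.image _).card_pos key
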